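/- arXiv:2107.11408 — 2 statements merged into one kernel-verified Lean document; each statement's English description precedes it below -/
import Mathlib

section
/- (RRK equals linearized RRK on skew-symmetric linear systems.) Let S be a real N×N skew-symmetric matrix, let (a_{ij}) with a_{ij} = 0 for j ≥ i and weights b_1, …, b_s be an s-stage explicit Runge–Kutta method, let Δt > 0, Δt* > 0, y_init ∈ ℝ^N, and K ≥ 2. Define the RRK sequences: y_0 = y_init; for k = 1, …, K−1 (IDT steps with step size Δt): Y_{k,i} = y_{k−1} + Δt Σ_{j<i} a_{ij} S Y_{k,j}, d_k = Δt Σ_i b_i S Y_{k,i} ≠ 0, γ_k = −2⟨y_{k−1}, d_k⟩/‖d_k‖², y_k = y_{k−1} + γ_k d_k; for the final step k = K (step size Δt*): Y_{K,i} = y_{K−1} + Δt* Σ_{j<i} a_{ij} S Y_{K,j}, d_K = Δt* Σ_i b_i S Y_{K,i} ≠ 0, γ_K = −2⟨y_{K−1}, d_K⟩/‖d_K‖², y_K = y_{K−1} + γ_K d_K. Define the linearized RRK sequences with zero sources: δ_0 = y_init; for k = 1, …, K−1: Δ_{k,i} = δ_{k−1} + Δt Σ_{j<i} a_{ij} S Δ_{k,j},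 ρ_k = ⟨−(2/‖d_k‖²) d_k, δ_{k−1}⟩ + Σ_i ⟨−(2 b_i Δt/‖d_k‖²) Sᵀ y_k, Δ_{k,i}⟩, δ_k = δ_{k−1} + γ_k Δt Σ_i b_i S Δ_{k,i} + ρ_k d_k; ρ_* = Σ_{k=1}^{K−1} ρ_k; final step: Δ_{K,i} = δ_{K−1} + Δt* Σ_{j<i} a_{ij} S Δ_{K,j} − ρ_* Δt Σ_{j<i} a_{ij} S Y_{K,j}, ρ_K = ⟨−(2/‖d_K‖²) d_K, δ_{K−1}⟩ + Σ_i ⟨−(2 b_i Δt*/‖d_K‖²) Sᵀ y_K, Δ_{K,i}⟩, δ_K = δ_{K−1} + γ_K Δt* Σ_i b_i S Δ_{K,i} + ρ_K d_K. Then δ_k = y_k and Δ_{k,i} = Y_{k,i} for all k = 0, …, K and all i, and ρ_* = 0. -/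
open scoped RealInnerProductSpace BigOperators
open Matrix

/-- The stage equations of an explicit Runge–Kutta method have at most one solution. -/
theorem explicit_stages_unique {E : Type*} [AddCommGroup E] [Module ℝ E] {s : ℕ}
    (A : E →ₗ[ℝ] E) {a : Fin s → Fin s → ℝ} (ha : ∀ i j : Fin s, i ≤ j → a i j = 0)
    {h : ℝ} {u : E} {X Z : Fin s → E}
    (hX : ∀ i, X i = u + h • ∑ j, a i j • A (X j))
    (hZ : ∀ i, Z i = u + h • ∑ j, a i j • A (Z j)) (i : Fin s) : X i = Z i := by
  induction i using WellFoundedLT.induction with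
  | ind i ih =>
    rw [hX i, hZ i]
    congr 2
    refine Finset.sum_congr rfl fun j _ => ?_
    rcases lt_or_ge j i with hj | hj
    · rw [ih j hj]
    · rw [ha i j hj, zero_smul, zero_smul]

/-- The Euclidean operator of the transpose is the adjoint of the operator of the matrix. -/
theorem inner_toEuclideanLin_transpose {N : ℕ} (S : Matrix (Fin N) (Fin N) ℝ)
    (x z : EuclideanSpace ℝ (Fin N)) :
    ⟪Matrix.toEuclideanLin Sᵀ x, z⟫ = ⟪x, Matrix.toEuclideanLin S z⟫ := by
  rw [← Matrix.conjTranspose_eq_transpose_of_trivial,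
    Matrix.toEuclideanLin_conjTranspose_eq_adjoint, LinearMap.adjoint_inner_left]

/-- Relaxation reflects the component along the search direction: `⟪u + γ d, d⟫ = -⟪u, d⟫`. -/
theorem inner_relaxed_update {E : Type*} [NormedAddCommGroup E] [InnerProductSpace ℝ E]
    {u d : E} (hd : d ≠ 0) :
    ⟪u + (-2 * ⟪u, d⟫ / ‖d‖ ^ 2) • d, d⟫ = -⟪u, d⟫ := by
  have hn : ‖d‖ ^ 2 ≠ 0 := pow_ne_zero 2 (norm_ne_zero_iff.mpr hd)
  rw [inner_add_left, real_inner_smul_left, real_inner_self_eq_norm_sq, div_mul_cancel₀ _ hn]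
  ring

/-- The linearized relaxation parameter vanishes when evaluated at the RRK solution itself. -/
theorem linearized_relaxation_eq_zero {N s : ℕ} (S : Matrix (Fin N) (Fin N) ℝ)
    {b : Fin s → ℝ} {h : ℝ} {u v d : EuclideanSpace ℝ (Fin N)}
    {X : Fin s → EuclideanSpace ℝ (Fin N)}
    (hd : d = h • ∑ i, b i • Matrix.toEuclideanLin S (X i)) (hd0 : d ≠ 0)
    (hv : v = u + (-2 * ⟪u, d⟫ / ‖d‖ ^ 2) • d) :
    ⟪(-(2 / ‖d‖ ^ 2)) • d, u⟫
      + ∑ i, ⟪(-(2 * b i * h / ‖d‖ ^ 2)) • Matrix.toEuclideanLin Sᵀ v, X i⟫ = 0 := by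
  have hvd : ⟪v, d⟫ = -⟪u, d⟫ := hv ▸ inner_relaxed_update hd0
  have hsum : ∑ i, ⟪(-(2 * b i * h / ‖d‖ ^ 2)) • Matrix.toEuclideanLin Sᵀ v, X i⟫
      = -(2 / ‖d‖ ^ 2) * ⟪v, d⟫ := by
    have hexp : ⟪v, d⟫ = h * ∑ i, b i * ⟪v, Matrix.toEuclideanLin S (X i)⟫ := by
      conv_lhs => rw [hd]
      simp only [real_inner_smul_right, inner_sum]
    rw [hexp, Finset.mul_sum, Finset.mul_sum]
    refine Finset.sum_congr rfl fun i _ => ?_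
    rw [real_inner_smul_left, inner_toEuclideanLin_transpose]
    ring
  rw [hsum, hvd, real_inner_smul_left, real_inner_comm d u]
  ring

/-- One linearized RRK step started from the RRK solution reproduces the RRK step. -/
theorem linearized_rrk_step {N s : ℕ} (S : Matrix (Fin N) (Fin N) ℝ)
    {a : Fin s → Fin s → ℝ} (ha : ∀ i j : Fin s, i ≤ j → a i j = 0)
    {b : Fin s → ℝ} {h g r : ℝ} {u v w d : EuclideanSpace ℝ (Fin N)}
    {X Z : Fin s → EuclideanSpace ℝ (Fin N)}
    (hX : ∀ i, X i = u + h • ∑ j, a i j • Matrix.toEuclideanLin S (X j))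
    (hd : d = h • ∑ i, b i • Matrix.toEuclideanLin S (X i)) (hd0 : d ≠ 0)
    (hg : g = -2 * ⟪u, d⟫ / ‖d‖ ^ 2) (hv : v = u + g • d)
    (hZ : ∀ i, Z i = u + h • ∑ j, a i j • Matrix.toEuclideanLin S (Z j))
    (hr : r = ⟪(-(2 / ‖d‖ ^ 2)) • d, u⟫
      + ∑ i, ⟪(-(2 * b i * h / ‖d‖ ^ 2)) • Matrix.toEuclideanLin Sᵀ v, Z i⟫)
    (hw : w = u + (g * h) • ∑ i, b i • Matrix.toEuclideanLin S (Z i) + r • d) :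
    w = v ∧ (∀ i, Z i = X i) ∧ r = 0 := by
  obtain rfl : Z = X := funext (explicit_stages_unique _ ha hZ hX)
  have hr0 : r = 0 := hr.trans (linearized_relaxation_eq_zero S hd hd0 (hg ▸ hv))
  refine ⟨?_, fun _ => rfl, hr0⟩
  rw [hw, hv, hr0, zero_smul, add_zero, mul_smul, ← hd]

/-- (RRK equals linearized RRK on skew-symmetric linear systems.)
For a skew-symmetric matrix `S` and an explicit Runge–Kutta method (`a i j = 0` for
`j ≥ i`), with `K − 1` IDT steps of size `Δt` followed by a final IDT step of corrected
size `Δt*`, if the RRK sequences `y, Y, d, γ` (with `d k ≠ 0`) and the linearized RRK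
sequences `δ, Δ, ρ, ρ*` (with zero sources and `δ₀ = y_init`) satisfy their defining
recursions, then `δ k = y k`, `Δ k i = Y k i` for all steps and stages, and `ρ* = 0`. -/
theorem rrk_equals_linearized_rrk_skew (N s K : ℕ) (hK : 2 ≤ K)
    (S : Matrix (Fin N) (Fin N) ℝ) (hS : Sᵀ = -S)
    (a : Fin s → Fin s → ℝ) (ha : ∀ i j : Fin s, i ≤ j → a i j = 0)
    (b : Fin s → ℝ) (Δt Δts : ℝ) (hΔt : 0 < Δt) (hΔts : 0 < Δts)
    (yinit : EuclideanSpace ℝ (Fin N))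
    (y δ : ℕ → EuclideanSpace ℝ (Fin N))
    (Y Δ : ℕ → Fin s → EuclideanSpace ℝ (Fin N))
    (d : ℕ → EuclideanSpace ℝ (Fin N)) (γ ρ : ℕ → ℝ) (ρstar : ℝ)
    -- RRK (forward) recursions: IDT steps of size Δt for k = 1, …, K−1
    (hy0 : y 0 = yinit)
    (hY : ∀ k, 1 ≤ k → k ≤ K - 1 → ∀ i, Y k i
      = y (k - 1) + Δt • ∑ j, a i j • Matrix.toEuclideanLin S (Y k j))
    (hd : ∀ k, 1 ≤ k → k ≤ K - 1 →
      d k = Δt • ∑ i, b i • Matrix.toEuclideanLin S (Y k i))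
    -- final forward step of size Δt*
    (hYK : ∀ i, Y K i
      = y (K - 1) + Δts • ∑ j, a i j • Matrix.toEuclideanLin S (Y K j))
    (hdK : d K = Δts • ∑ i, b i • Matrix.toEuclideanLin S (Y K i))
    (hdne : ∀ k, 1 ≤ k → k ≤ K → d k ≠ 0)
    (hγ : ∀ k, 1 ≤ k → k ≤ K → γ k = -2 * ⟪y (k - 1), d k⟫ / ‖d k‖ ^ 2)
    (hy : ∀ k, 1 ≤ k → k ≤ K → y k = y (k - 1) + γ k • d k)
    -- linearized RRK recursions (zero sources): steps k = 1, …, K−1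
    (hδ0 : δ 0 = yinit)
    (hΔ : ∀ k, 1 ≤ k → k ≤ K - 1 → ∀ i, Δ k i
      = δ (k - 1) + Δt • ∑ j, a i j • Matrix.toEuclideanLin S (Δ k j))
    (hρ : ∀ k, 1 ≤ k → k ≤ K - 1 → ρ k
      = ⟪(-(2 / ‖d k‖ ^ 2)) • d k, δ (k - 1)⟫
        + ∑ i, ⟪(-(2 * b i * Δt / ‖d k‖ ^ 2)) • Matrix.toEuclideanLin Sᵀ (y k), Δ k i⟫)
    (hδ : ∀ k, 1 ≤ k → k ≤ K - 1 → δ k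
      = δ (k - 1) + (γ k * Δt) • ∑ i, b i • Matrix.toEuclideanLin S (Δ k i)
        + ρ k • d k)
    (hρstar : ρstar = ∑ k ∈ Finset.Icc 1 (K - 1), ρ k)
    -- final linearized step of size Δt*
    (hΔK : ∀ i, Δ K i
      = δ (K - 1) + Δts • ∑ j, a i j • Matrix.toEuclideanLin S (Δ K j)
        - (ρstar * Δt) • ∑ j, a i j • Matrix.toEuclideanLin S (Y K j))
    (hρK : ρ K
      = ⟪(-(2 / ‖d K‖ ^ 2)) • d K, δ (K - 1)⟫
        + ∑ i, ⟪(-(2 * b i * Δts / ‖d K‖ ^ 2)) • Matrix.toEuclideanLin Sᵀ (y K), Δ K i⟫)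
    (hδK : δ K
      = δ (K - 1) + (γ K * Δts) • ∑ i, b i • Matrix.toEuclideanLin S (Δ K i)
        + ρ K • d K) :
    (∀ k, k ≤ K → δ k = y k) ∧
    (∀ k, 1 ≤ k → k ≤ K → ∀ i, Δ k i = Y k i) ∧
    ρstar = 0 := by
  have step : ∀ k, 1 ≤ k → k ≤ K - 1 → δ (k - 1) = y (k - 1) →
      δ k = y k ∧ (∀ i, Δ k i = Y k i) ∧ ρ k = 0 := by
    intro k hk hkK hprev
    have hkK' : k ≤ K := hkK.trans (Nat.sub_le K 1)
    exact linearized_rrk_step S ha (hY k hk hkK) (hd k hk hkK) (hdne k hk hkK')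
      (hγ k hk hkK') (hy k hk hkK') (hprev ▸ hΔ k hk hkK) (hprev ▸ hρ k hk hkK)
      (hprev ▸ hδ k hk hkK)
  have agree : ∀ k, k ≤ K - 1 → δ k = y k := by
    intro k
    induction k with
    | zero => exact fun _ => hδ0.trans hy0.symm
    | succ k ih => exact fun hk => (step (k + 1) (by omega) hk (ih (by omega))).1
  have hρ0 : ρstar = 0 := by
    rw [hρstar]
    refine Finset.sum_eq_zero fun k hk => ?_
    obtain ⟨hk1, hk2⟩ := Finset.mem_Icc.mp hk
    exact (step k hk1 hk2 (agree _ (by omega))).2.2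
  have hlast := agree (K - 1) le_rfl
  simp only [hρ0, zero_mul, zero_smul, sub_zero] at hΔK
  have final := linearized_rrk_step S ha hYK hdK (hdne K (by omega) le_rfl)
    (hγ K (by omega) le_rfl) (hy K (by omega) le_rfl) (hlast ▸ hΔK) (hlast ▸ hρK) (hlast ▸ hδK)
  refine ⟨fun k hk => ?_, fun k hk1 hk => ?_, hρ0⟩
  · rcases hk.eq_or_lt with rfl | hlt
    · exact final.1
    · exact agree k (by omega)
  · rcases hk.eq_or_lt with rfl | hlt
    · exact final.2.1
    · exact (step k hk1 (by omega) (agree _ (by omega))).2.1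
end

section
/- (The discrete adjoint of an explicit Runge–Kutta step is the transpose of its linearization.) Let J_1, …, J_s be real N×N matrices, (a_{ij}) with a_{ij} = 0 for j ≥ i and b_1, …, b_s real Runge–Kutta coefficients, and Δt ∈ ℝ. For δ ∈ ℝ^N define the linearized RK step T(δ) := δ + Δt Σ_{i=1}^s b_i J_i Δ_i, where Δ_i = δ + Δt Σ_{j<i} a_{ij} J_j Δ_j. For λ ∈ ℝ^N define the adjoint RK step T*(λ) := λ + Σ_{i=1}^s Λ_i, where Λ_i = Δt J_iᵀ (b_i λ + Σ_{j>i} a_{ji} Λ_j). Then ⟨T(δ), λ⟩ = ⟨δ, T*(λ)⟩ for all δ, λ ∈ ℝ^N. -/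
open scoped RealInnerProductSpace BigOperators
open Matrix

/-- The transpose of a real matrix is its adjoint for the Euclidean inner product. -/
lemma inner_toEuclideanLin_transpose_s15 {m n : Type*} [Fintype m] [DecidableEq m] [Fintype n]
    [DecidableEq n] (A : Matrix m n ℝ) (x : EuclideanSpace ℝ n) (y : EuclideanSpace ℝ m) :
    ⟪x, Matrix.toEuclideanLin Aᵀ y⟫ = ⟪Matrix.toEuclideanLin A x, y⟫ := by
  rw [← Matrix.conjTranspose_eq_transpose_of_trivial,
    Matrix.toEuclideanLin_conjTranspose_eq_adjoint, LinearMap.adjoint_inner_right]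

/-- (The discrete adjoint of an explicit Runge–Kutta step is the
transpose of its linearization.) For stage Jacobians `J i`, explicit coefficients
(`a i j = 0` for `j ≥ i`) and weights `b`, if `Δ` solves the linearized RK stage
equations for `δ` and `Λ` solves the adjoint RK stage equations for `λ`, then
`⟨T(δ), λ⟩ = ⟨δ, T*(λ)⟩` where `T(δ) = δ + Δt ∑ᵢ bᵢ Jᵢ Δᵢ` and `T*(λ) = λ + ∑ᵢ Λᵢ`. -/
theorem rk_adjoint_step_is_transpose (N s : ℕ)
    (J : Fin s → Matrix (Fin N) (Fin N) ℝ)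
    (a : Fin s → Fin s → ℝ) (ha : ∀ i j : Fin s, i ≤ j → a i j = 0)
    (b : Fin s → ℝ) (Δt : ℝ)
    (δ lam : EuclideanSpace ℝ (Fin N))
    (Δ Λ : Fin s → EuclideanSpace ℝ (Fin N))
    (hΔ : ∀ i, Δ i = δ + Δt • ∑ j, a i j • Matrix.toEuclideanLin (J j) (Δ j))
    (hΛ : ∀ i, Λ i
      = Δt • Matrix.toEuclideanLin (J i)ᵀ (b i • lam + ∑ j, a j i • Λ j)) :
    ⟪δ + Δt • ∑ i, b i • Matrix.toEuclideanLin (J i) (Δ i), lam⟫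
      = ⟪δ, lam + ∑ i, Λ i⟫ := by
  have forward (i : Fin s) : ⟪Δ i, Λ i⟫
      = ⟪δ, Λ i⟫ + Δt * ∑ j, a i j * ⟪Matrix.toEuclideanLin (J j) (Δ j), Λ i⟫ := by
    conv_lhs => rw [hΔ i]
    simp only [inner_add_left, real_inner_smul_left, sum_inner]
  have backward (i : Fin s) : ⟪Δ i, Λ i⟫
      = Δt * (b i * ⟪Matrix.toEuclideanLin (J i) (Δ i), lam⟫
        + ∑ j, a j i * ⟪Matrix.toEuclideanLin (J i) (Δ i), Λ j⟫) := by
    conv_lhs => rw [hΛ i]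
    simp only [real_inner_smul_right, inner_toEuclideanLin_transpose_s15, inner_add_right, inner_sum]
  have total := Finset.sum_congr rfl fun i (_ : i ∈ Finset.univ) =>
    (forward i).symm.trans (backward i)
  simp only [mul_add, Finset.sum_add_distrib, ← Finset.mul_sum] at total
  rw [Finset.sum_comm] at total
  simp only [inner_add_left, inner_add_right, real_inner_smul_left, sum_inner, inner_sum]
  linarith
end
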